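/- Let Δ(s) = 2^s·π^{s−1}·Γ(1−s)·sin(πs/2) and fix a compact interval [σ₁, σ₂] ⊂ ℝ. There is a constant C > 0 such that for all σ ∈ [σ₁, σ₂], all real δ with |δ| ≤ 1, and all real t ≥ 2 with Δ(σ+it) ≠ 0, | Δ(σ + i(δ+t)) / Δ(σ+it) − exp(−iδ·log(t/(2π))) | ≤ C/t. -/

import Mathlib

open Complex Real

/-- The factor `Δ(s) = 2^s·π^{s−1}·Γ(1−s)·sin(πs/2)` from the functional equation
`ζ(s) = Δ(s)·ζ(1−s)` of the Riemann zeta function. -/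
noncomputable def zetaDelta : ℂ → ℂ :=
  fun s => 2 ^ s * (π : ℂ) ^ (s - 1) * Complex.Gamma (1 - s) * Complex.sin (π * s / 2)

theorem Real.exp_div_sub_one_le {a t : ℝ} (ha : 0 ≤ a) (ht : 1 ≤ t) :
    Real.exp (a / t) - 1 ≤ a * Real.exp a / t := by
  have h0 : 0 ≤ a / t := by positivity
  have h1 : a / t ≤ a := div_le_self ha ht
  have h2 : Real.exp (a / t) - 1 ≤ a / t * Real.exp (a / t) := by
    have h := mul_le_mul_of_nonneg_right (Real.add_one_le_exp (-(a / t)))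
      (Real.exp_pos (a / t)).le
    rw [← Real.exp_add, neg_add_cancel, Real.exp_zero] at h
    linarith
  calc Real.exp (a / t) - 1 ≤ a / t * Real.exp (a / t) := h2
    _ ≤ a / t * Real.exp a := by gcongr
    _ = a * Real.exp a / t := by ring

theorem Complex.norm_mul_sub_one_le_div {A B : ℂ} {a b t : ℝ} (ht : 1 ≤ t)
    (hA : ‖A - 1‖ ≤ a / t) (hB : ‖B - 1‖ ≤ b / t) :
    ‖A * B - 1‖ ≤ (a + b + a * b) / t := by
  have ht0 : 0 < t := by linarith
  have ha : 0 ≤ a := by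
    have := (norm_nonneg _).trans hA
    rwa [le_div_iff₀ ht0, zero_mul] at this
  have hb : 0 ≤ b := by
    have := (norm_nonneg _).trans hB
    rwa [le_div_iff₀ ht0, zero_mul] at this
  calc ‖A * B - 1‖ = ‖(A - 1) + (B - 1) + (A - 1) * (B - 1)‖ := by congr 1; ring
    _ ≤ ‖A - 1‖ + ‖B - 1‖ + ‖A - 1‖ * ‖B - 1‖ := by
      refine (norm_add_le _ _).trans ?_
      rw [norm_mul]
      gcongr
      exact norm_add_le _ _
    _ ≤ a / t + b / t + a / t * b := by
      gcongr
      exact hB.trans (div_le_self hb ht)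
    _ = (a + b + a * b) / t := by ring

theorem Complex.norm_log_add_one_sub_log_sub_inv_le {u : ℂ} (hu : 2 ≤ ‖u‖) (him : u.im < 0) :
    ‖Complex.log (u + 1) - Complex.log u - 1 / u‖ ≤ 2 / ‖u‖ ^ 2 := by
  have hu0 : u ≠ 0 := by rintro rfl; simp at him
  have key := Convex.norm_image_sub_le_of_norm_hasDerivWithin_le (𝕜 := ℂ)
    (f := fun x => Complex.log x - x / u) (f' := fun x => 1 / x - 1 / u)
    (s := Metric.closedBall u 1 ∩ {x : ℂ | x.im < 0}) (x := u) (y := u + 1) (C := 2 / ‖u‖ ^ 2)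
    (fun x hx => by
      have hx' : x ∈ slitPlane := Or.inr (ne_of_lt hx.2)
      have := (Complex.hasDerivAt_log hx').sub ((hasDerivAt_id x).div_const u)
      simpa [Pi.sub_def] using this.hasDerivWithinAt)
    (fun x hx => by
      have h1 : ‖x - u‖ ≤ 1 := by simpa [dist_eq_norm] using hx.1
      have hx0 : x ≠ 0 := by rintro rfl; simpa using hx.2
      have h2 : ‖u‖ / 2 ≤ ‖x‖ := by
        have : ‖u‖ ≤ ‖x‖ + ‖x - u‖ := by
          calc ‖u‖ = ‖x - (x - u)‖ := by congr 1; ring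
            _ ≤ _ := norm_sub_le _ _
        linarith
      have hpos : 0 < ‖u‖ := by linarith
      calc ‖1 / x - 1 / u‖ = ‖x - u‖ / (‖x‖ * ‖u‖) := by
            rw [← norm_mul, ← norm_neg (x - u), ← norm_div]
            congr 1
            field_simp
            ring
        _ ≤ 1 / (‖u‖ / 2 * ‖u‖) := by gcongr
        _ = 2 / ‖u‖ ^ 2 := by field_simp)
    ((convex_closedBall u 1).inter (convex_halfSpace_im_lt 0))
    ⟨by simp, him⟩ ⟨by simp [dist_eq_norm], by simpa using him⟩
  have e : Complex.log (u + 1) - (u + 1) / u - (Complex.log u - u / u) =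
      Complex.log (u + 1) - Complex.log u - 1 / u := by ring
  simpa only [e, add_sub_cancel_left, norm_one, mul_one] using key

theorem Complex.norm_div_add_mul_exp_sub_one_le {u w : ℂ} (hu : 2 ≤ ‖u‖) (him : u.im < 0)
    (hw : ‖w‖ ≤ 1) :
    ‖u / (u + w) * cexp (w * (Complex.log (u + 1) - Complex.log u)) - 1‖ ≤ 12 / ‖u‖ ^ 2 := by
  have hpos : 0 < ‖u‖ := by linarith
  have hu0 : u ≠ 0 := norm_pos_iff.1 hpos
  have hlog := norm_log_add_one_sub_log_sub_inv_le hu him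
  set ℓ := Complex.log (u + 1) - Complex.log u
  have hden : ‖u‖ / 2 ≤ ‖u + w‖ := by
    have : ‖u‖ ≤ ‖u + w‖ + ‖w‖ := by
      calc ‖u‖ = ‖(u + w) - w‖ := by congr 1; ring
        _ ≤ _ := norm_sub_le _ _
    linarith
  have hden0 : u + w ≠ 0 := norm_pos_iff.1 (by linarith)
  have hℓ : ‖ℓ‖ ≤ 2 / ‖u‖ := by
    calc ‖ℓ‖ = ‖(ℓ - 1 / u) + 1 / u‖ := by congr 1; ring
      _ ≤ ‖ℓ - 1 / u‖ + ‖1 / u‖ := norm_add_le _ _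
      _ ≤ 2 / ‖u‖ ^ 2 + 1 / ‖u‖ := by
        gcongr
        simp
      _ ≤ 2 / ‖u‖ := by
        rw [div_add_div _ _ (by positivity) (by positivity), div_le_div_iff₀ (by positivity) hpos]
        nlinarith [pow_pos hpos 2, pow_pos hpos 3]
  have hwℓ : ‖w * ℓ‖ ≤ 2 / ‖u‖ := by
    rw [norm_mul]
    calc ‖w‖ * ‖ℓ‖ ≤ 1 * (2 / ‖u‖) := by gcongr
      _ = _ := one_mul _
  have hexp : ‖cexp (w * ℓ) - 1 - w * ℓ‖ ≤ 4 / ‖u‖ ^ 2 := by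
    have h1 : ‖w * ℓ‖ ≤ 1 := hwℓ.trans (by rw [div_le_one hpos]; exact hu)
    calc _ ≤ ‖w * ℓ‖ ^ 2 := norm_exp_sub_one_sub_id_le h1
      _ ≤ (2 / ‖u‖) ^ 2 := by gcongr
      _ = _ := by ring
  have hmain : ‖cexp (w * ℓ) - (u + w) / u‖ ≤ 6 / ‖u‖ ^ 2 := by
    calc ‖cexp (w * ℓ) - (u + w) / u‖
        = ‖(cexp (w * ℓ) - 1 - w * ℓ) + w * (ℓ - 1 / u)‖ := by
          congr 1
          field_simp
          ring
      _ ≤ ‖cexp (w * ℓ) - 1 - w * ℓ‖ + ‖w‖ * ‖ℓ - 1 / u‖ := by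
          rw [← norm_mul]; exact norm_add_le _ _
      _ ≤ 4 / ‖u‖ ^ 2 + 1 * (2 / ‖u‖ ^ 2) := by gcongr
      _ = _ := by ring
  calc ‖u / (u + w) * cexp (w * ℓ) - 1‖
      = ‖u‖ / ‖u + w‖ * ‖cexp (w * ℓ) - (u + w) / u‖ := by
        rw [← norm_div, ← norm_mul]
        congr 1
        field_simp
    _ ≤ ‖u‖ / (‖u‖ / 2) * (6 / ‖u‖ ^ 2) := by gcongr
    _ = 12 / ‖u‖ ^ 2 := by field_simp; norm_num

theorem sum_range_inv_add_sq_le {t : ℝ} (ht : 2 ≤ t) (n : ℕ) :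
    ∑ j ∈ Finset.range n, 1 / ((j : ℝ) + t) ^ 2 ≤ 2 / t := by
  calc ∑ j ∈ Finset.range n, 1 / ((j : ℝ) + t) ^ 2
      ≤ ∑ j ∈ Finset.range n, (1 / ((j : ℝ) + t - 1) - 1 / (((j + 1 : ℕ) : ℝ) + t - 1)) := by
        refine Finset.sum_le_sum fun j _ => ?_
        have hj : (0 : ℝ) ≤ j := j.cast_nonneg
        have h1 : 0 < (j : ℝ) + t - 1 := by linarith
        have h2 : 0 < (j : ℝ) + t := by linarith
        push_cast
        rw [show (j : ℝ) + 1 + t - 1 = j + t by ring, div_sub_div _ _ h1.ne' h2.ne',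
          div_le_div_iff₀ (by positivity) (by positivity)]
        nlinarith
    _ = 1 / (t - 1) - 1 / ((n : ℝ) + t - 1) := by
        rw [Finset.sum_range_sub' (fun j : ℕ => 1 / ((j : ℝ) + t - 1))]
        simp
    _ ≤ 1 / (t - 1) := by
        have hn : (0 : ℝ) ≤ n := n.cast_nonneg
        have : 0 ≤ 1 / ((n : ℝ) + t - 1) := by
          apply div_nonneg <;> linarith
        linarith
    _ ≤ 2 / t := by
        rw [div_le_div_iff₀ (by linarith) (by linarith)]
        linarith

/-- Along a horizontal line at distance `t` from the real axis, the sum of `‖z + j‖⁻²` is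
`O(1 / t)`, uniformly for bounded real part. -/
theorem Complex.sum_range_inv_norm_add_sq_le {z : ℂ} {M t : ℝ} (hM : |z.re| ≤ M) (ht : 2 ≤ t)
    (hz : z.im = -t) (n : ℕ) :
    ∑ j ∈ Finset.range n, 12 / ‖z + j‖ ^ 2 ≤ 48 * (M + 1) ^ 2 / t := by
  have hM0 : 0 ≤ M := (abs_nonneg _).trans hM
  calc ∑ j ∈ Finset.range n, 12 / ‖z + j‖ ^ 2
      ≤ ∑ j ∈ Finset.range n, 24 * (M + 1) ^ 2 * (1 / ((j : ℝ) + t) ^ 2) := by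
        refine Finset.sum_le_sum fun j _ => ?_
        have hj : (0 : ℝ) ≤ j := j.cast_nonneg
        have hsq : ‖z + j‖ ^ 2 = (z.re + j) ^ 2 + t ^ 2 := by
          rw [Complex.sq_norm, Complex.normSq_apply]
          simp [hz]
          ring
        have habs : (j : ℝ) - M ≤ |z.re + j| := by
          have := neg_abs_le z.re
          have := le_abs_self (z.re + j)
          linarith
        have hlin : (j : ℝ) + t ≤ (M + 1) * (|z.re + j| + t) := by
          nlinarith [abs_nonneg (z.re + j), mul_nonneg hM0 (abs_nonneg (z.re + j))]
        have hquad : ((j : ℝ) + t) ^ 2 ≤ (M + 1) ^ 2 * (2 * ‖z + j‖ ^ 2) := by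
          calc ((j : ℝ) + t) ^ 2 ≤ ((M + 1) * (|z.re + j| + t)) ^ 2 := by gcongr
            _ = (M + 1) ^ 2 * (|z.re + j| + t) ^ 2 := by ring
            _ ≤ (M + 1) ^ 2 * (2 * ‖z + j‖ ^ 2) := by
              gcongr
              rw [hsq, ← sq_abs (z.re + j)]
              nlinarith [sq_nonneg (|z.re + j| - t)]
        have hpos : 0 < ‖z + j‖ ^ 2 := by rw [hsq]; positivity
        rw [mul_one_div, div_le_div_iff₀ hpos (by positivity)]
        linarith
    _ = 24 * (M + 1) ^ 2 * ∑ j ∈ Finset.range n, 1 / ((j : ℝ) + t) ^ 2 :=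
        (Finset.mul_sum _ _ _).symm
    _ ≤ 24 * (M + 1) ^ 2 * (2 / t) := by
        gcongr
        exact sum_range_inv_add_sq_le ht n
    _ = 48 * (M + 1) ^ 2 / t := by ring

theorem Complex.tendsto_log_add_nat_sub_log_nat (z : ℂ) :
    Filter.Tendsto (fun n : ℕ => Complex.log (z + n) - Complex.log n) Filter.atTop (nhds 0) := by
  have h1 : Filter.Tendsto (fun n : ℕ => z / n + 1) Filter.atTop (nhds (0 + 1)) :=
    (tendsto_const_div_atTop_nhds_zero_nat z).add_const 1
  rw [zero_add] at h1
  have h2 := (Complex.hasDerivAt_log one_mem_slitPlane).continuousAt.tendsto.comp h1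
  rw [Complex.log_one] at h2
  refine h2.congr' ?_
  filter_upwards [Filter.eventually_gt_atTop 0, h1.eventually_ne one_ne_zero] with n hn hne
  have hn' : (0 : ℝ) < n := by exact_mod_cast hn
  have hnC : (n : ℂ) ≠ 0 := by exact_mod_cast hn.ne'
  have h := Complex.log_ofReal_mul hn' hne
  rw [Complex.ofReal_log hn'.le] at h
  push_cast at h
  rw [mul_add, mul_one, mul_div_cancel₀ _ hnC] at h
  simp [h]

/-- Quantitative form of `Γ(z + w) ∼ Γ(z) z ^ w` on horizontal lines in the lower half-plane. -/
theorem Complex.norm_Gamma_add_div_Gamma_sub_one_le {z w : ℂ} {M t : ℝ} (hM : |z.re| ≤ M)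
    (ht : 2 ≤ t) (hz : z.im = -t) (hw : ‖w‖ ≤ 1) :
    ‖Complex.Gamma (z + w) / Complex.Gamma z * cexp (-(w * Complex.log z)) - 1‖ ≤
      48 * (M + 1) ^ 2 * Real.exp (48 * (M + 1) ^ 2) / t := by
  have him : ∀ j : ℕ, (z + j).im < 0 := fun j => by simp [hz]; linarith
  have hnorm : ∀ j : ℕ, 2 ≤ ‖z + j‖ := fun j => by
    have h := abs_im_le_norm (z + j)
    simp only [add_im, natCast_im, add_zero, hz, abs_neg] at h
    linarith [le_abs_self t]
  have hne : ∀ j : ℕ, z + j ≠ 0 := fun j => norm_pos_iff.1 (by linarith [hnorm j])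
  have hne' : ∀ j : ℕ, z + w + j ≠ 0 := fun j h0 => by
    have h1 : z + j = -w := by linear_combination h0
    have h2 := hnorm j
    rw [h1, norm_neg] at h2
    linarith
  have hΓ : Complex.Gamma z ≠ 0 :=
    Complex.Gamma_ne_zero fun m h => hne m (by rw [h]; ring)
  have hprod : ∀ n : ℕ, ‖∏ j ∈ Finset.range n, ((z + j) / (z + j + w) *
      cexp (w * (Complex.log (z + j + 1) - Complex.log (z + j)))) - 1‖ ≤
      48 * (M + 1) ^ 2 * Real.exp (48 * (M + 1) ^ 2) / t := fun n => by
    have h := Finset.norm_prod_one_add_sub_one_le (Finset.range n) fun j : ℕ =>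
      (z + j) / (z + j + w) * cexp (w * (Complex.log (z + j + 1) - Complex.log (z + j))) - 1
    simp only [add_sub_cancel] at h
    refine h.trans (le_trans ?_ (Real.exp_div_sub_one_le (by positivity) (by linarith)))
    gcongr
    refine (Finset.sum_le_sum fun j _ => ?_).trans (sum_range_inv_norm_add_sq_le hM ht hz n)
    exact norm_div_add_mul_exp_sub_one_le (hnorm j) (him j) hw
  have htel : ∀ n : ℕ, ∏ j ∈ Finset.range n, ((z + j) / (z + j + w) *
      cexp (w * (Complex.log (z + j + 1) - Complex.log (z + j)))) =
      (∏ j ∈ Finset.range n, (z + j)) / (∏ j ∈ Finset.range n, (z + w + j)) *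
        cexp (w * (Complex.log (z + n) - Complex.log z)) := fun n => by
    rw [Finset.prod_mul_distrib, Finset.prod_div_distrib, ← Complex.exp_sum, ← Finset.mul_sum]
    have hs := Finset.sum_range_sub (fun j : ℕ => Complex.log (z + j)) n
    simp only [Nat.cast_add, Nat.cast_one, Nat.cast_zero, add_zero, ← add_assoc] at hs
    rw [hs]
    simp only [add_right_comm z _ w]
  have hlim : Filter.Tendsto (fun n : ℕ => ∏ j ∈ Finset.range (n + 1), ((z + j) / (z + j + w) *
      cexp (w * (Complex.log (z + j + 1) - Complex.log (z + j))))) Filter.atTop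
      (nhds (Complex.Gamma (z + w) / Complex.Gamma z * cexp (-(w * Complex.log z)))) := by
    have h1 := (Complex.GammaSeq_tendsto_Gamma (z + w)).div (Complex.GammaSeq_tendsto_Gamma z) hΓ
    have h2 := ((tendsto_log_add_nat_sub_log_nat (z + 1)).const_mul w).cexp
    rw [mul_zero, Complex.exp_zero] at h2
    have h3 := (h1.mul h2).mul_const (cexp (-(w * Complex.log z)))
    rw [mul_one] at h3
    refine h3.congr' ?_
    filter_upwards [Filter.eventually_gt_atTop 0] with n hn
    have hnC : (n : ℂ) ≠ 0 := by exact_mod_cast hn.ne'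
    have hP : ∏ j ∈ Finset.range (n + 1), (z + j) ≠ 0 := Finset.prod_ne_zero_iff.2 fun j _ => hne j
    have hQ : ∏ j ∈ Finset.range (n + 1), (z + w + j) ≠ 0 :=
      Finset.prod_ne_zero_iff.2 fun j _ => hne' j
    have hf : (n.factorial : ℂ) ≠ 0 := by exact_mod_cast n.factorial_ne_zero
    have hp : (n : ℂ) ^ z ≠ 0 := by simp [Complex.cpow_eq_zero_iff, hnC]
    have hnw : (n : ℂ) ^ w = cexp (w * Complex.log n) := by
      rw [Complex.cpow_def_of_ne_zero hnC, mul_comm]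
    have hexp : cexp (w * Complex.log n) * cexp (w * (Complex.log (z + 1 + n) - Complex.log n)) *
        cexp (-(w * Complex.log z)) =
        cexp (w * (Complex.log (z + (n + 1 : ℕ)) - Complex.log z)) := by
      rw [← Complex.exp_add, ← Complex.exp_add]
      push_cast
      rw [show z + (n + 1 : ℂ) = z + 1 + n by ring]
      congr 1
      ring
    rw [htel, ← hexp, ← hnw]
    simp only [Pi.div_apply, Complex.GammaSeq, Complex.cpow_add _ _ hnC]
    field_simp
  exact le_of_tendsto' ((hlim.sub_const 1).norm) fun n => hprod (n + 1)

theorem Complex.norm_log_sub_log_of_im_eq_neg {z : ℂ} {t : ℝ} (ht : 0 < t) (hz : z.im = -t) :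
    ‖Complex.log z - (Real.log t - π / 2 * I)‖ ≤ |z.re| / t := by
  have hlog : Complex.log (t * -I) = Real.log t - π / 2 * I := by
    rw [Complex.log_ofReal_mul ht (by simp), Complex.log_neg_I]
    ring
  have key := Convex.norm_image_sub_le_of_norm_hasDerivWithin_le (𝕜 := ℂ)
    (f := Complex.log) (f' := fun x => x⁻¹) (s := {x : ℂ | x.im ≤ -t})
    (x := t * -I) (y := z) (C := 1 / t)
    (fun x hx => by
      have hx' : x ∈ slitPlane := Or.inr (ne_of_lt (lt_of_le_of_lt hx (by linarith)))
      exact (Complex.hasDerivAt_log hx').hasDerivWithinAt)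
    (fun x hx => by
      have h1 : t ≤ ‖x‖ := by
        have h2 : x.im ≤ -t := hx
        have := neg_abs_le x.im
        linarith [abs_im_le_norm x]
      rw [norm_inv, ← one_div]
      gcongr)
    (convex_halfSpace_im_le _) (by simp) hz.le
  have hsub : z - t * -I = z.re := by
    apply Complex.ext <;> simp [hz]
  rw [hlog, hsub, Complex.norm_real, Real.norm_eq_abs] at key
  exact key.trans_eq (by ring)

theorem Complex.norm_cexp_sub_one_le_div {x : ℂ} {a t : ℝ} (ht : 1 ≤ t) (hx : ‖x‖ ≤ a / t) :
    ‖cexp x - 1‖ ≤ a * Real.exp a / t := by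
  have ha : 0 ≤ a := by
    have := (norm_nonneg _).trans hx
    rwa [le_div_iff₀ (by linarith), zero_mul] at this
  have h := Complex.norm_exp_sub_sum_le_exp_norm_sub_sum x 1
  simp only [Finset.range_one, Finset.sum_singleton, pow_zero, Nat.factorial_zero, Nat.cast_one,
    div_one] at h
  exact (h.trans (by gcongr)).trans (Real.exp_div_sub_one_le ha ht)

theorem Complex.sin_eq_exp_mul_one_sub (v : ℂ) :
    Complex.sin v = I / 2 * cexp (-v * I) * (1 - cexp (2 * v * I)) := by
  have h1 : cexp (v * I) = cexp (-v * I) * cexp (2 * v * I) := by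
    rw [← Complex.exp_add]
    congr 1
    ring
  have h2 := Complex.two_sin v
  rw [h1] at h2
  linear_combination h2 / 2

theorem Real.exp_neg_pi_mul_le {t : ℝ} (ht : 0 < t) : Real.exp (-(π * t)) ≤ 1 / (3 * t) := by
  rw [Real.exp_neg, ← one_div]
  gcongr
  nlinarith [Real.add_one_le_exp (π * t), Real.pi_gt_three]

theorem Complex.norm_one_sub_div_one_sub_sub_one_le {a b : ℂ} {t : ℝ} (ht : 2 ≤ t)
    (ha : ‖a‖ ≤ 2 / (3 * t)) (hb : ‖b‖ ≤ 1 / (3 * t)) :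
    ‖(1 - a) / (1 - b) - 1‖ ≤ 2 / t := by
  have hb2 : ‖b‖ ≤ 1 / 2 := hb.trans (by
    rw [div_le_div_iff₀ (by linarith) (by norm_num)]
    linarith)
  have hden : 1 / 2 ≤ ‖1 - b‖ := by
    have := norm_sub_norm_le 1 b
    rw [norm_one] at this
    linarith
  have hne : 1 - b ≠ 0 := norm_pos_iff.1 (by linarith)
  calc ‖(1 - a) / (1 - b) - 1‖ = ‖b - a‖ / ‖1 - b‖ := by
        rw [← norm_div]
        congr 1
        field_simp
        ring
    _ ≤ (1 / (3 * t) + 2 / (3 * t)) / (1 / 2) := by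
        gcongr
        exact (norm_sub_le _ _).trans (add_le_add hb ha)
    _ = 2 / t := by
        field_simp
        norm_num

/-- The shift ratio of `zetaDelta`, normalised by its limiting phase, as a product of three factors
each of which is close to `1`. -/
theorem zetaDelta_add_div_zetaDelta (σ δ : ℝ) {t : ℝ} (ht : 0 < t) :
    zetaDelta (σ + (δ + t) * I) / zetaDelta (σ + t * I) =
      cexp (-I * δ * Real.log (t / (2 * π))) *
      ((Complex.Gamma (1 - (σ + t * I) + -(δ * I)) / Complex.Gamma (1 - (σ + t * I)) *
          cexp (-(-(δ * I) * Complex.log (1 - (σ + t * I))))) *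
        cexp (-(δ * I) * (Complex.log (1 - (σ + t * I)) - (Real.log t - π / 2 * I))) *
        ((1 - cexp (2 * (π * (σ + (δ + t) * I) / 2) * I)) /
          (1 - cexp (2 * (π * (σ + t * I) / 2) * I)))) := by
  have hπ : (π : ℂ) ≠ 0 := by exact_mod_cast Real.pi_ne_zero
  have hlog : (Real.log (t / (2 * π)) : ℂ) =
      Real.log t - Complex.log 2 - Complex.log π := by
    rw [Real.log_div ht.ne' (by positivity), Real.log_mul two_ne_zero Real.pi_ne_zero,
      ← Complex.ofReal_log Real.pi_pos.le]
    push_cast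
    rw [Complex.ofReal_log zero_le_two]
    push_cast
    ring
  simp only [zetaDelta, Complex.sin_eq_exp_mul_one_sub, Complex.cpow_def_of_ne_zero two_ne_zero,
    Complex.cpow_def_of_ne_zero hπ, hlog]
  rw [show (1 : ℂ) - (σ + (δ + t) * I) = 1 - (σ + t * I) + -(δ * I) by ring]
  set s : ℂ := σ + t * I
  rw [show (σ : ℂ) + (δ + t) * I = s + δ * I by simp only [s]; ring]
  set L := Complex.log (1 - s)
  have hE : cexp (Complex.log 2 * (s + δ * I)) * cexp (Complex.log π * (s + δ * I - 1)) *
        cexp (-(π * (s + δ * I) / 2) * I) =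
      cexp (-I * δ * (Real.log t - Complex.log 2 - Complex.log π)) * cexp (-(-(δ * I) * L)) *
        cexp (-(δ * I) * (L - (Real.log t - π / 2 * I))) *
        (cexp (Complex.log 2 * s) * cexp (Complex.log π * (s - 1)) * cexp (-(π * s / 2) * I)) := by
    simp only [← Complex.exp_add]
    congr 1
    ring
  have hI : (I / 2 : ℂ) ≠ 0 := by simp
  generalize cexp (2 * (π * (s + δ * I) / 2) * I) = a
  generalize cexp (2 * (π * s / 2) * I) = b
  generalize Complex.Gamma (1 - s + -(δ * I)) = G
  generalize Complex.Gamma (1 - s) = H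
  have hN : cexp (Complex.log 2 * s) * cexp (Complex.log π * (s - 1)) *
      cexp (-(π * s / 2) * I) ≠ 0 := by
    simp [Complex.exp_ne_zero]
  set N := cexp (Complex.log 2 * s) * cexp (Complex.log π * (s - 1)) * cexp (-(π * s / 2) * I)
    with hNdef
  rw [show cexp (Complex.log 2 * (s + δ * I)) * cexp (Complex.log π * (s + δ * I - 1)) * G *
      (I / 2 * cexp (-(π * (s + δ * I) / 2) * I) * (1 - a)) =
      (cexp (Complex.log 2 * (s + δ * I)) * cexp (Complex.log π * (s + δ * I - 1)) *
        cexp (-(π * (s + δ * I) / 2) * I)) * (I / 2) * G * (1 - a) by ring, hE,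
    show cexp (Complex.log 2 * s) * cexp (Complex.log π * (s - 1)) * H *
      (I / 2 * cexp (-(π * s / 2) * I) * (1 - b)) = N * (I / 2) * H * (1 - b) by
      rw [hNdef]; ring]
  have hNI : N * (I / 2) ≠ 0 := mul_ne_zero hN hI
  rw [mul_assoc (N * (I / 2)), show ∀ x y z : ℂ, x * y * z * N * (I / 2) * G * (1 - a) =
    (N * (I / 2)) * (x * y * z * G * (1 - a)) by intros; ring, mul_div_mul_left _ _ hNI,
    mul_div_mul_comm]
  ring

/-- For a compact interval `[σ₁, σ₂]` there is a constant `C > 0` such that for all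
`σ ∈ [σ₁, σ₂]`, all real `δ` with `|δ| ≤ 1` and all real `t ≥ 2` with `Δ(σ+it) ≠ 0`,
`| Δ(σ+i(δ+t))/Δ(σ+it) − exp(−iδ·log(t/(2π))) | ≤ C/t`. -/
theorem zetaDelta_shift_ratio (σ₁ σ₂ : ℝ) :
    ∃ C : ℝ, 0 < C ∧ ∀ σ δ t : ℝ, σ₁ ≤ σ → σ ≤ σ₂ → |δ| ≤ 1 → 2 ≤ t →
      zetaDelta (σ + t * I) ≠ 0 →
      ‖zetaDelta (σ + (δ + t) * I) / zetaDelta (σ + t * I) -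
        Complex.exp (-I * δ * Real.log (t / (2 * π)))‖ ≤ C / t := by
  set M : ℝ := 1 + |σ₁| + |σ₂|
  set a : ℝ := 48 * (M + 1) ^ 2 * Real.exp (48 * (M + 1) ^ 2)
  set b : ℝ := M * Real.exp M
  set c : ℝ := a + b + a * b
  have hM : 0 < M := by positivity
  refine ⟨c + 2 + c * 2, by positivity, fun σ δ t h₁ h₂ hδ ht _ => ?_⟩
  have ht0 : 0 < t := by linarith
  have hδl := (abs_le.1 hδ).1
  have hw : ‖-((δ : ℂ) * I)‖ ≤ 1 := by simpa using hδ
  have hre : |(1 - ((σ : ℂ) + t * I)).re| ≤ M := by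
    have e : (1 - ((σ : ℂ) + t * I)).re = 1 - σ := by simp
    rw [e, abs_le]
    constructor <;> simp only [M] <;>
      linarith [neg_abs_le σ₁, le_abs_self σ₂, abs_nonneg σ₁, abs_nonneg σ₂]
  have him : (1 - ((σ : ℂ) + t * I)).im = -t := by simp
  have hA := Complex.norm_Gamma_add_div_Gamma_sub_one_le hre ht him hw
  have hB : ‖cexp (-(δ * I) * (Complex.log (1 - (σ + t * I)) - (Real.log t - π / 2 * I))) - 1‖ ≤
      b / t := by
    refine Complex.norm_cexp_sub_one_le_div (by linarith) ?_
    rw [norm_mul]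
    calc _ ≤ 1 * (|(1 - ((σ : ℂ) + t * I)).re| / t) := by
          gcongr
          exact Complex.norm_log_sub_log_of_im_eq_neg ht0 him
      _ ≤ M / t := by rw [one_mul]; gcongr
  have hD : ‖(1 - cexp (2 * (π * (σ + (δ + t) * I) / 2) * I)) /
      (1 - cexp (2 * (π * (σ + t * I) / 2) * I)) - 1‖ ≤ 2 / t := by
    apply Complex.norm_one_sub_div_one_sub_sub_one_le ht
    · rw [Complex.norm_exp]
      have e : (2 * (π * (σ + (δ + t) * I) / 2) * I : ℂ).re = -(π * (δ + t)) := by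
        rw [mul_div_cancel₀ _ (two_ne_zero' ℂ)]
        simp
      rw [e]
      refine (Real.exp_neg_pi_mul_le (by linarith)).trans ?_
      rw [div_le_div_iff₀ (by linarith) (by linarith)]
      linarith
    · rw [Complex.norm_exp]
      have e : (2 * (π * (σ + t * I) / 2) * I : ℂ).re = -(π * t) := by
        rw [mul_div_cancel₀ _ (two_ne_zero' ℂ)]
        simp
      rw [e]
      exact Real.exp_neg_pi_mul_le ht0
  have hE : ‖cexp (-I * δ * Real.log (t / (2 * π)))‖ = 1 := by
    rw [Complex.norm_exp]
    simp
  rw [zetaDelta_add_div_zetaDelta σ δ ht0, ← mul_sub_one, norm_mul, hE, one_mul]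
  exact Complex.norm_mul_sub_one_le_div (by linarith)
    (Complex.norm_mul_sub_one_le_div (by linarith) hA hB) hD
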